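/- arXiv:1703.03984 — 5 statements merged into one kernel-verified Lean document; each statement's English description precedes it below -/
import Mathlib

section
/- Let k and n be integers with 2 ≤ k ≤ n, and let T be a tree of order n with exactly r leaves. Then sdiam_k(T) = n − 1 if and only if r ≤ k. -/
open SimpleGraph

/-- The Steiner distance of a vertex set `S` in `G`: the minimum number of edges of a
connected subgraph of `G` whose vertex set contains `S` (`⊤` if no such subgraph exists). -/
noncomputable def steinerDist {V : Type*} (G : SimpleGraph V) (S : Set V) : ℕ∞ :=
  sInf {m : ℕ∞ | ∃ H : G.Subgraph, H.Connected ∧ S ⊆ H.verts ∧ m = H.edgeSet.ncard}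

/-- The Steiner `k`-diameter of `G`: the maximum of `steinerDist G S` over all
`k`-element vertex subsets `S`. -/
noncomputable def sdiam {V : Type*} (G : SimpleGraph V) (k : ℕ) : ℕ∞ :=
  sSup {m : ℕ∞ | ∃ S : Set V, S.ncard = k ∧ m = steinerDist G S}

/-- `v` is a cut vertex of `G` if deleting `v` disconnects `G`. -/
def IsCutVertex {V : Type*} (G : SimpleGraph V) (v : V) : Prop :=
  ¬ (G.induce ({v}ᶜ : Set V)).Connected

/-- `U` is a vertex cut set of the induced subgraph `G[A]` if `U ⊆ A` and deleting `U`
from `G[A]` leaves a disconnected graph. -/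
def IsCutSetOf {V : Type*} (G : SimpleGraph V) (A U : Set V) : Prop :=
  U ⊆ A ∧ ¬ (G.induce (A \ U)).Connected

/-- The vertex connectivity of the induced subgraph `G[A]`: the minimum size of a set
`U ⊆ A` whose removal disconnects `G[A]` or reduces it to a single vertex. -/
noncomputable def kappaOn {V : Type*} (G : SimpleGraph V) (A : Set V) : ℕ :=
  sInf {m : ℕ | ∃ U : Set V, U ⊆ A ∧ U.ncard = m ∧
    (¬ (G.induce (A \ U)).Connected ∨ (A \ U).ncard = 1)}

/-- The vertex connectivity `κ(G)`. -/
noncomputable def kappa {V : Type*} (G : SimpleGraph V) : ℕ :=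
  kappaOn G Set.univ

namespace SimpleGraph

variable {V : Type*} {G : SimpleGraph V}

/-- In a finite tree, every vertex `v ≠ u` lies on a path from `u` to a leaf. -/
lemma IsTree.exists_isPath_to_leaf_mem_support [Fintype V] [DecidableRel G.Adj] (hT : G.IsTree)
    {u v : V} (huv : u ≠ v) :
    ∃ w, G.degree w = 1 ∧ ∃ p : G.Walk u w, p.IsPath ∧ v ∈ p.support := by
  classical
  let P : ℕ → Prop := fun m ↦ ∃ w, ∃ p : G.Walk u w, p.IsPath ∧ v ∈ p.support ∧ p.length = m
  have hbound : ∀ m, P m → m ≤ Fintype.card V := by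
    rintro m ⟨w, p, hp, -, rfl⟩
    exact hp.length_lt.le
  obtain ⟨q, hq⟩ := hT.connected.exists_isPath u v
  have hP : P q.length := ⟨v, q, hq, q.end_mem_support, rfl⟩
  obtain ⟨w, p, hp, hv, hlen⟩ := Nat.findGreatest_spec (hbound _ hP) hP
  refine ⟨w, ?_, p, hp, hv⟩
  have hnil : ¬ p.Nil := fun h ↦ by
    cases h
    simp_all
  rw [degree_eq_one_iff_existsUnique_adj]
  refine ⟨_, (p.adj_penultimate hnil).symm, fun x hadj ↦ ?_⟩
  refine hT.isAcyclic.eq_penultimate_of_adj_end hp hadj (by_contra fun hx ↦ ?_)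
  have hP' : P (p.length + 1) :=
    ⟨x, p.concat hadj, hp.concat hx hadj, by simp [Walk.support_concat, hv], by simp⟩
  have := Nat.le_findGreatest (hbound _ hP') hP'
  lia

/-- In a finite tree, every connected subgraph that contains all the leaves is spanning. -/
lemma IsTree.verts_eq_univ_of_leaves_subset [Fintype V] [DecidableRel G.Adj] (hT : G.IsTree)
    {H : G.Subgraph} (hH : H.Connected) (hleaf : {v | G.degree v = 1} ⊆ H.verts) :
    H.verts = Set.univ := by
  obtain ⟨⟨u, hu⟩, hconn⟩ := H.connected_iff_forall_exists_walk_subgraph.mp hH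
  refine Set.eq_univ_of_forall fun v ↦ ?_
  obtain rfl | huv := eq_or_ne u v
  · exact hu
  obtain ⟨w, hw, p, hp, hv⟩ := hT.exists_isPath_to_leaf_mem_support huv
  obtain ⟨q, hq⟩ := hconn hu (hleaf hw)
  classical
  have hpq : p = q.bypass :=
    congrArg Subtype.val <|
      (hT.isAcyclic.subsingleton_path u w).elim ⟨p, hp⟩ ⟨_, q.bypass_isPath⟩
  refine hq.1 ?_
  rw [Walk.mem_verts_toSubgraph]
  exact q.support_bypass_subset_support (hpq ▸ hv)

lemma Subgraph.Connected.ncard_verts_le_ncard_edgeSet_add_one {H : G.Subgraph}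
    (hH : H.Connected) : H.verts.ncard ≤ H.edgeSet.ncard + 1 := by
  have h := hH.coe.card_vert_le_card_edgeSet_add_one
  rwa [Nat.card_coe_set_eq, Nat.card_coe_set_eq, ← Set.ncard_image_of_injective _
    (Sym2.map.injective Subtype.val_injective), H.image_coe_edgeSet_coe] at h

lemma IsTree.ncard_edgeSet_add_one [Fintype V] (hT : G.IsTree) :
    G.edgeSet.ncard + 1 = Fintype.card V := by
  rw [← Nat.card_coe_set_eq, ← Nat.card_eq_fintype_card]
  exact (isTree_iff_connected_and_card.mp hT).2

end SimpleGraph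

section SteinerDistance

variable {V : Type*} {G : SimpleGraph V}

lemma steinerDist_le {H : G.Subgraph} {S : Set V} (hH : H.Connected) (hS : S ⊆ H.verts) :
    steinerDist G S ≤ H.edgeSet.ncard :=
  sInf_le ⟨H, hH, hS, rfl⟩

lemma steinerDist_le_ncard_edgeSet (hG : G.Connected) (S : Set V) :
    steinerDist G S ≤ G.edgeSet.ncard := by
  simpa using steinerDist_le (H := ⊤) (S := S)
    (Subgraph.connected_iff'.mpr (Subgraph.topIso.connected_iff.mpr hG)) (by simp)

variable [Fintype V] [DecidableRel G.Adj]

/-- The Steiner distance of a set missing a leaf is less than the number of edges. -/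
lemma steinerDist_lt_of_leaf_notMem (hG : G.Connected) {S : Set V} {v : V}
    (hv : G.degree v = 1) (hvS : v ∉ S) : steinerDist G S < G.edgeSet.ncard := by
  have hconn := connected_induce_iff.mp (hG.induce_compl_singleton_of_degree_eq_one hv)
  refine (steinerDist_le hconn (by simpa using hvS)).trans_lt ?_
  obtain ⟨u, hu, -⟩ := degree_eq_one_iff_existsUnique_adj.mp hv
  refine Nat.cast_lt.mpr (Set.ncard_lt_ncard (Set.ssubset_iff_of_subset
    (Subgraph.edgeSet_subset _) |>.mpr ⟨s(v, u), hu, ?_⟩) (Set.toFinite _))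
  simp

/-- The Steiner distance of a set containing all leaves of a tree is the order minus one. -/
lemma steinerDist_eq_of_leaves_subset (hT : G.IsTree) {S : Set V}
    (hS : {v | G.degree v = 1} ⊆ S) : steinerDist G S = G.edgeSet.ncard := by
  refine (steinerDist_le_ncard_edgeSet hT.connected S).antisymm (le_sInf ?_)
  rintro _ ⟨H, hH, hSH, rfl⟩
  have h := hH.ncard_verts_le_ncard_edgeSet_add_one
  rw [hT.verts_eq_univ_of_leaves_subset hH (hS.trans hSH), Set.ncard_univ,
    Nat.card_eq_fintype_card, ← hT.ncard_edgeSet_add_one] at h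
  exact Nat.cast_le.mpr (by lia)

end SteinerDistance

/-- For a tree `T` of order `n` with exactly `r` leaves and `2 ≤ k ≤ n`,
`sdiam_k(T) = n - 1` if and only if `r ≤ k`. -/
theorem sdiam_tree_eq_iff {V : Type*} [Fintype V] (G : SimpleGraph V) [DecidableRel G.Adj]
    (hT : G.IsTree) (n k r : ℕ) (hn : Fintype.card V = n) (hk2 : 2 ≤ k) (hkn : k ≤ n)
    (hr : {v : V | G.degree v = 1}.ncard = r) :
    sdiam G k = (↑(n - 1) : ℕ∞) ↔ r ≤ k := by
  have hcard := hT.ncard_edgeSet_add_one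
  rw [show n - 1 = G.edgeSet.ncard by lia]
  constructor
  · intro h
    by_contra! hrk
    refine (sSup_le (a := ((G.edgeSet.ncard - 1 : ℕ) : ℕ∞)) ?_).not_gt
      (h.symm ▸ Nat.cast_lt.mpr (by lia) : _ < sdiam G k)
    rintro _ ⟨S, hS, rfl⟩
    obtain ⟨v, hv, hvS⟩ := Set.exists_mem_notMem_of_ncard_lt_ncard
      (show S.ncard < {v : V | G.degree v = 1}.ncard by lia)
    rw [ENat.natCast_sub, Nat.cast_one]
    exact ENat.le_sub_one_of_lt (steinerDist_lt_of_leaf_notMem hT.connected hv hvS)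
  · intro hrk
    refine le_antisymm (sSup_le ?_) ?_
    · rintro _ ⟨S, -, rfl⟩
      exact steinerDist_le_ncard_edgeSet hT.connected S
    · obtain ⟨S, hS, -, hSk⟩ := Set.exists_subsuperset_card_eq
        (Set.subset_univ {v : V | G.degree v = 1}) (hr.trans_le hrk)
        (by rwa [Set.ncard_univ, Nat.card_eq_fintype_card, hn])
      exact le_sSup ⟨S, hSk, (steinerDist_eq_of_leaves_subset hT hS).symm⟩
end

section
/- Let k and n be integers with 1 ≤ k ≤ n − 2, and let G be a connected graph of order n. Then sdiam_{n−k}(G) = n − 1 if and only if G contains at least k cut vertices. -/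
open SimpleGraph

namespace SimpleGraph

variable {V : Type*} {G : SimpleGraph V}

theorem Subgraph.Connected.ncard_verts_le [Finite V] {H : G.Subgraph} (hH : H.Connected) :
    H.verts.ncard ≤ H.edgeSet.ncard + 1 := by
  have h := hH.coe.card_vert_le_card_edgeSet_add_one
  have hle : H.coe.edgeSet.ncard ≤ H.edgeSet.ncard := by
    refine Set.ncard_le_ncard_of_injOn (Sym2.map Subtype.val) ?_
      (Sym2.map.injective Subtype.val_injective).injOn (Set.toFinite _)
    rintro ⟨x, y⟩ hxy
    exact hxy
  rw [Nat.card_coe_set_eq, Nat.card_coe_set_eq] at h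
  omega

theorem exists_subgraph_ncard_edgeSet [Finite V] {A : Set V} (hA : (G.induce A).Connected) :
    ∃ H : G.Subgraph, H.Connected ∧ H.verts = A ∧ H.edgeSet.ncard + 1 ≤ A.ncard := by
  obtain ⟨T, hle, hT⟩ := hA.exists_isTree_le
  let H : G.Subgraph :=
    { verts := A
      Adj := fun x y ↦ ∃ (hx : x ∈ A) (hy : y ∈ A), T.Adj ⟨x, hx⟩ ⟨y, hy⟩
      adj_sub := fun ⟨_, _, h⟩ ↦ hle h
      edge_vert := fun ⟨hx, _, _⟩ ↦ hx
      symm := ⟨fun _ _ ⟨hx, hy, h⟩ ↦ ⟨hy, hx, h.symm⟩⟩ }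
  refine ⟨H, ⟨hT.connected.mono fun x y h ↦ ⟨x.2, y.2, h⟩⟩, rfl, ?_⟩
  have hsub : H.edgeSet ⊆ Sym2.map Subtype.val '' T.edgeSet := by
    rintro ⟨x, y⟩ ⟨hx, hy, h⟩
    exact ⟨s(⟨x, hx⟩, ⟨y, hy⟩), h, rfl⟩
  have h1 := (Set.ncard_le_ncard hsub).trans (Set.ncard_image_le (Set.toFinite _))
  have h2 := (isTree_iff_connected_and_card.1 hT).2
  rw [Nat.card_coe_set_eq, Nat.card_coe_set_eq] at h2
  omega

theorem Connected.exists_connected_induce_compl_singleton [Finite V] (hG : G.Connected)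
    {A : Set V} (hA : (G.induce A).Connected) (hne : A ≠ Set.univ) :
    ∃ v ∉ A, (G.induce ({v}ᶜ : Set V)).Connected := by
  obtain ⟨B, hAB, hB⟩ := Finite.exists_le_maximal
    (p := fun B : Set V ↦ (G.induce B).Connected ∧ B ≠ Set.univ) ⟨hA, hne⟩
  obtain ⟨u, hu⟩ := hB.prop.1.nonempty
  obtain ⟨w, hw⟩ := (Set.ne_univ_iff_exists_notMem B).1 hB.prop.2
  obtain ⟨p⟩ := hG.preconnected u w
  obtain ⟨⟨⟨b, c⟩, hbc⟩, -, hb, hc⟩ := p.exists_boundary_dart B hu hw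
  have hconn : (G.induce (B ∪ {c})).Connected :=
    connected_induce_union hB.prop.1.preconnected Preconnected.of_subsingleton hb
      (Set.mem_singleton c) hbc
  have huniv : B ∪ {c} = Set.univ := by
    by_contra hne'
    exact hc (hB.le_of_ge ⟨hconn, hne'⟩ Set.subset_union_left (Or.inr rfl))
  have hBc : B = {c}ᶜ := by
    ext x
    have hx : x ∈ B ∪ {c} := huniv ▸ Set.mem_univ x
    grind
  exact ⟨c, fun h ↦ hc (hAB h), hBc ▸ hB.prop.1⟩

theorem steinerDist_add_one_le [Finite V] {A S : Set V} (hA : (G.induce A).Connected)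
    (hS : S ⊆ A) : steinerDist G S + 1 ≤ A.ncard := by
  obtain ⟨H, hH, hv, hcard⟩ := exists_subgraph_ncard_edgeSet hA
  have h : steinerDist G S ≤ H.edgeSet.ncard := sInf_le ⟨H, hH, hv ▸ hS, rfl⟩
  calc steinerDist G S + 1 ≤ (H.edgeSet.ncard : ℕ∞) + 1 := by gcongr
    _ ≤ A.ncard := by exact_mod_cast hcard

theorem Connected.steinerDist_add_one_le_card [Finite V] (hG : G.Connected) (S : Set V) :
    steinerDist G S + 1 ≤ Nat.card V := by
  rw [← Set.ncard_univ]
  exact steinerDist_add_one_le ((induceUnivIso G).connected_iff.2 hG) (Set.subset_univ S)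

theorem Connected.card_le_steinerDist_add_one [Finite V] (hG : G.Connected) {S : Set V}
    (hS : ∀ v ∉ S, IsCutVertex G v) : (Nat.card V : ℕ∞) ≤ steinerDist G S + 1 := by
  have key : ((Nat.card V - 1 : ℕ) : ℕ∞) ≤ steinerDist G S := by
    refine le_sInf ?_
    rintro _ ⟨H, hH, hSH, rfl⟩
    have hv : H.verts = Set.univ := by
      by_contra hne
      obtain ⟨v, hv, hconn⟩ := hG.exists_connected_induce_compl_singleton
        (hH.coe.mono fun _ _ h ↦ H.adj_sub h) hne
      exact hS v (fun h ↦ hv (hSH h)) hconn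
    have h := hH.ncard_verts_le
    rw [hv, Set.ncard_univ] at h
    exact_mod_cast Nat.sub_le_iff_le_add.2 h
  calc (Nat.card V : ℕ∞) ≤ ((Nat.card V - 1 : ℕ) : ℕ∞) + 1 := by
        exact_mod_cast Nat.sub_le_iff_le_add.1 le_rfl
    _ ≤ steinerDist G S + 1 := by gcongr

end SimpleGraph

/-- For a connected graph `G` of order `n` and `1 ≤ k ≤ n - 2`,
`sdiam_{n-k}(G) = n - 1` if and only if `G` has at least `k` cut vertices. -/
theorem sdiam_eq_iff_cutVertices {V : Type*} [Fintype V] (G : SimpleGraph V)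
    (hG : G.Connected) (n k : ℕ) (hn : Fintype.card V = n) (hk1 : 1 ≤ k) (hkn : k ≤ n - 2) :
    sdiam G (n - k) = (↑(n - 1) : ℕ∞) ↔ k ≤ {v : V | IsCutVertex G v}.ncard := by
  have hcard : Nat.card V = n := Nat.card_eq_fintype_card.trans hn
  have hupper (S : Set V) : steinerDist G S ≤ ((n - 1 : ℕ) : ℕ∞) := by
    have h := hG.steinerDist_add_one_le_card S
    rw [hcard, show n = n - 1 + 1 by omega, Nat.cast_add, Nat.cast_one] at h
    exact (ENat.add_le_add_iff_right ENat.one_ne_top).1 h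
  constructor
  · intro h
    by_contra! hlt
    have hle : sdiam G (n - k) ≤ ((n - 2 : ℕ) : ℕ∞) := by
      refine sSup_le ?_
      rintro _ ⟨S, hS, rfl⟩
      obtain ⟨v, hvS, hv⟩ : ∃ v ∉ S, ¬ IsCutVertex G v := by
        by_contra! hall
        have h1 : Sᶜ.ncard ≤ {v : V | IsCutVertex G v}.ncard := Set.ncard_le_ncard hall
        have h2 := Set.ncard_add_ncard_compl S
        omega
      have h1 := steinerDist_add_one_le (not_not.1 hv) (Set.subset_compl_singleton_iff.2 hvS)
      have h2 := Set.ncard_add_ncard_compl {v}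
      rw [Set.ncard_singleton] at h2
      rw [show ({v}ᶜ : Set V).ncard = n - 2 + 1 by omega, Nat.cast_add, Nat.cast_one] at h1
      exact (ENat.add_le_add_iff_right ENat.one_ne_top).1 h1
    rw [h, Nat.cast_le] at hle
    omega
  · intro h
    refine le_antisymm (sSup_le ?_) ?_
    · rintro _ ⟨S, -, rfl⟩
      exact hupper S
    · obtain ⟨C, hC, hCk⟩ := Set.exists_subset_card_eq h
      have h1 := hG.card_le_steinerDist_add_one (S := Cᶜ) fun v hv ↦ hC (not_not.1 hv)
      rw [hcard, show n = n - 1 + 1 by omega, Nat.cast_add, Nat.cast_one] at h1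
      refine ((ENat.add_le_add_iff_right ENat.one_ne_top).1 h1).trans (le_sSup ⟨Cᶜ, ?_, rfl⟩)
      have h2 := Set.ncard_add_ncard_compl C
      omega
end

section
/- Let k and n be integers with 1 ≤ k ≤ n − 2, and let G be a connected graph of order n. Then the vertex connectivity of G satisfies κ(G) ≥ k if and only if sdiam_{n−k+1}(G) = n − k. -/
open SimpleGraph

/-- A connected subgraph of a finite graph has at most one more vertex than edges. -/
lemma SimpleGraph.Subgraph.Connected.ncard_verts_le_s6 {V : Type*} [Finite V] {G : SimpleGraph V}
    {H : G.Subgraph} (hH : H.Connected) : H.verts.ncard ≤ H.edgeSet.ncard + 1 := by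
  have h := hH.coe.card_vert_le_card_edgeSet_add_one
  rw [Nat.card_coe_set_eq, Nat.card_coe_set_eq] at h
  rwa [← H.image_coe_edgeSet_coe,
    Set.ncard_image_of_injective _ (Sym2.map.injective Subtype.val_injective)]

/-- A connected induced subgraph `G[S]` contains a spanning tree, as a subgraph of `G`. -/
lemma SimpleGraph.exists_connected_subgraph_verts_eq {V : Type*} [Finite V] {G : SimpleGraph V}
    {S : Set V} (hS : (G.induce S).Connected) :
    ∃ H : G.Subgraph, H.Connected ∧ H.verts = S ∧ H.edgeSet.ncard + 1 = S.ncard := by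
  obtain ⟨T, hTle, hT⟩ := hS.exists_isTree_le
  let H : G.Subgraph :=
    { verts := S
      Adj := fun u v ↦ ∃ (hu : u ∈ S) (hv : v ∈ S), T.Adj ⟨u, hu⟩ ⟨v, hv⟩
      adj_sub := fun ⟨_, _, h⟩ ↦ hTle h
      edge_vert := fun ⟨hu, _, _⟩ ↦ hu
      symm := ⟨fun _ _ ⟨hu, hv, h⟩ ↦ ⟨hv, hu, h.symm⟩⟩ }
  have hHT : H.coe = T := by
    ext u v
    exact ⟨fun ⟨_, _, h⟩ ↦ h, fun h ↦ ⟨u.2, v.2, h⟩⟩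
  refine ⟨H, ⟨hHT ▸ hT.connected⟩, rfl, ?_⟩
  have h := (isTree_iff_connected_and_card.1 hT).2
  rw [Nat.card_coe_set_eq, Nat.card_coe_set_eq] at h
  rw [← H.image_coe_edgeSet_coe,
    Set.ncard_image_of_injective _ (Sym2.map.injective Subtype.val_injective), hHT, h]

lemma ncard_le_steinerDist_add_one {V : Type*} [Finite V] (G : SimpleGraph V) (S : Set V) :
    (S.ncard : ℕ∞) ≤ steinerDist G S + 1 := by
  by_cases htop : steinerDist G S = ⊤
  · simp [htop]
  have hne : {m : ℕ∞ | ∃ H : G.Subgraph, H.Connected ∧ S ⊆ H.verts ∧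
      m = H.edgeSet.ncard}.Nonempty := by
    by_contra h
    exact htop (by rw [steinerDist, Set.not_nonempty_iff_eq_empty.1 h, sInf_empty])
  obtain ⟨H, hH, hSH, hm⟩ := csInf_mem hne
  rw [steinerDist, hm]
  exact_mod_cast (Set.ncard_le_ncard hSH).trans hH.ncard_verts_le_s6

/-- A vertex set of size `m + 1` has Steiner distance at most `m` iff it induces a connected
subgraph. -/
lemma steinerDist_le_iff {V : Type*} [Finite V] {G : SimpleGraph V} {S : Set V} {m : ℕ}
    (hS : S.ncard = m + 1) : steinerDist G S ≤ m ↔ (G.induce S).Connected := by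
  constructor
  · intro hle
    have hne : {m : ℕ∞ | ∃ H : G.Subgraph, H.Connected ∧ S ⊆ H.verts ∧
        m = H.edgeSet.ncard}.Nonempty := by
      by_contra h
      rw [steinerDist, Set.not_nonempty_iff_eq_empty.1 h, sInf_empty] at hle
      simp at hle
    obtain ⟨H, hH, hSH, hm⟩ := csInf_mem hne
    rw [steinerDist, hm] at hle
    have hle' : H.edgeSet.ncard ≤ m := by exact_mod_cast hle
    have hv := hH.ncard_verts_le_s6
    rw [Set.eq_of_subset_of_ncard_le hSH (by omega)]
    exact hH.induce_verts
  · intro hconn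
    obtain ⟨H, hH, hHS, hcard⟩ := exists_connected_subgraph_verts_eq hconn
    refine sInf_le ⟨H, hH, hHS.ge, ?_⟩
    have : m = H.edgeSet.ncard := by omega
    rw [this]

/-- On a finite graph with more than `m` vertices, the Steiner `(m + 1)`-diameter is `m` iff every
`(m + 1)`-element vertex set induces a connected subgraph. -/
lemma sdiam_eq_iff {V : Type*} [Finite V] {G : SimpleGraph V} {m : ℕ} (hm : m + 1 ≤ Nat.card V) :
    sdiam G (m + 1) = m ↔ ∀ S : Set V, S.ncard = m + 1 → (G.induce S).Connected := by
  constructor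
  · intro h S hS
    rw [← steinerDist_le_iff hS, ← h]
    exact le_sSup ⟨S, hS, rfl⟩
  · intro h
    refine le_antisymm (sSup_le ?_) ?_
    · rintro _ ⟨S, hS, rfl⟩
      exact (steinerDist_le_iff hS).2 (h S hS)
    · obtain ⟨S, -, hS⟩ := Set.exists_subset_card_eq (s := (Set.univ : Set V)) (n := m + 1)
        (by rwa [Set.ncard_univ])
      refine le_trans ?_ (le_sSup ⟨S, hS, rfl⟩)
      have := ncard_le_steinerDist_add_one G S
      rw [hS, Nat.cast_add, Nat.cast_one] at this
      exact (ENat.add_le_add_iff_right ENat.one_ne_top).1 this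

/-- If all vertex sets of a fixed size `m ≥ 2` induce connected subgraphs, so do all larger ones. -/
lemma SimpleGraph.induce_connected_of_le_ncard {V : Type*} [Finite V] {G : SimpleGraph V} {m : ℕ}
    (hm : 2 ≤ m) (h : ∀ S : Set V, S.ncard = m → (G.induce S).Connected) {A : Set V}
    (hA : m ≤ A.ncard) : (G.induce A).Connected := by
  have hne : A.Nonempty := Set.nonempty_of_ncard_ne_zero (by omega)
  have := hne.to_subtype
  refine ⟨fun u v ↦ ?_⟩
  have huv : ({u.1, v.1} : Set V) ⊆ A := Set.insert_subset u.2 (Set.singleton_subset_iff.2 v.2)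
  obtain ⟨S, hS, hSA, hcard⟩ :=
    Set.exists_subsuperset_card_eq huv (((Set.ncard_insert_le _ _).trans (by simp)).trans hm) hA
  exact ((h S hcard).preconnected ⟨u, hS (by simp)⟩ ⟨v, hS (by simp)⟩).map
    (G.induceHomOfLE hSA).toHom

/-- For `k` at most `|V| - 2`, `k ≤ κ(G)` iff deleting fewer than `k` vertices never disconnects
`G`. -/
lemma le_kappa_iff {V : Type*} [Finite V] {G : SimpleGraph V} {k : ℕ} (hk : k + 2 ≤ Nat.card V) :
    k ≤ kappa G ↔ ∀ U : Set V, U.ncard < k → (G.induce Uᶜ).Connected := by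
  have hne : {m : ℕ | ∃ U : Set V, U ⊆ Set.univ ∧ U.ncard = m ∧
      (¬ (G.induce (Set.univ \ U)).Connected ∨ (Set.univ \ U).ncard = 1)}.Nonempty := by
    refine ⟨_, Set.univ, subset_rfl, rfl, Or.inl fun h ↦ ?_⟩
    obtain ⟨v, hv⟩ := h.nonempty
    exact hv.2 trivial
  rw [kappa, kappaOn, le_csInf_iff (OrderBot.bddBelow _) hne]
  constructor
  · intro h U hU
    by_contra hcon
    rw [Set.compl_eq_univ_sdiff] at hcon
    exact hU.not_ge (h _ ⟨U, Set.subset_univ U, rfl, Or.inl hcon⟩)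
  · rintro h _ ⟨U, -, rfl, hU⟩
    rw [← Set.compl_eq_univ_sdiff] at hU
    by_contra! hlt
    have := Set.ncard_add_ncard_compl U
    rcases hU with hU | hU
    · exact hU (h U hlt)
    · omega

/-- For a connected graph `G` of order `n` and `1 ≤ k ≤ n - 2`,
`κ(G) ≥ k` if and only if `sdiam_{n-k+1}(G) = n - k`. -/
theorem kappa_ge_iff_sdiam {V : Type*} [Fintype V] (G : SimpleGraph V) (hG : G.Connected)
    (n k : ℕ) (hn : Fintype.card V = n) (hk1 : 1 ≤ k) (hkn : k ≤ n - 2) :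
    k ≤ kappa G ↔ sdiam G (n - k + 1) = (↑(n - k) : ℕ∞) := by
  have hcard : Nat.card V = n := by rw [Nat.card_eq_fintype_card, hn]
  rw [le_kappa_iff (by omega), sdiam_eq_iff (by omega)]
  constructor
  · intro h S hS
    have := Set.ncard_add_ncard_compl S
    rw [← compl_compl S]
    exact h Sᶜ (by omega)
  · intro h U hU
    have := Set.ncard_add_ncard_compl U
    exact induce_connected_of_le_ncard (by omega) h (by omega)
end

section
/- Let G be a connected graph of order n ≥ 5. Then sdiam_{n−3}(G) = n − 1 if and only if G contains at least three cut vertices. -/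
open SimpleGraph

theorem ncard_edgeSet_coe {V : Type*} {G : SimpleGraph V} (H : G.Subgraph) :
    H.coe.edgeSet.ncard = H.edgeSet.ncard := by
  rw [← H.image_coe_edgeSet_coe]
  exact (Set.ncard_image_of_injective _ (Sym2.map.injective Subtype.val_injective)).symm

theorem ncard_verts_le_ncard_edgeSet_add_one {V : Type*} {G : SimpleGraph V} {H : G.Subgraph}
    (hH : H.Connected) : H.verts.ncard ≤ H.edgeSet.ncard + 1 := by
  rw [← ncard_edgeSet_coe]
  exact hH.coe.card_vert_le_card_edgeSet_add_one

theorem exists_connected_subgraph_ncard_edgeSet {V : Type*} [Finite V] {G : SimpleGraph V}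
    {A : Set V} (hA : (G.induce A).Connected) :
    ∃ H : G.Subgraph, H.Connected ∧ H.verts = A ∧ H.edgeSet.ncard + 1 = A.ncard := by
  obtain ⟨T, hle, hT⟩ := hA.exists_isTree_le
  let H : G.Subgraph :=
    { verts := A
      Adj := fun x y => ∃ (hx : x ∈ A) (hy : y ∈ A), T.Adj ⟨x, hx⟩ ⟨y, hy⟩
      adj_sub := fun ⟨_, _, h⟩ => hle h
      edge_vert := fun ⟨hx, _, _⟩ => hx
      symm := ⟨fun _ _ ⟨hx, hy, h⟩ => ⟨hy, hx, h.symm⟩⟩ }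
  have hcoe : H.coe = T := by
    ext x y
    exact ⟨fun ⟨_, _, h⟩ => h, fun h => ⟨x.2, y.2, h⟩⟩
  refine ⟨H, ⟨?_⟩, rfl, ?_⟩
  · rw [hcoe]
    exact hT.connected
  · rw [← ncard_edgeSet_coe, hcoe]
    exact (isTree_iff_connected_and_card.mp hT).2

theorem steinerDist_le_ncard_sub_one {V : Type*} [Finite V] {G : SimpleGraph V}
    {A S : Set V} (hA : (G.induce A).Connected) (hS : S ⊆ A) :
    steinerDist G S ≤ (A.ncard - 1 : ℕ) := by
  obtain ⟨H, hH, hv, he⟩ := exists_connected_subgraph_ncard_edgeSet hA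
  refine sInf_le ⟨H, hH, hv ▸ hS, ?_⟩
  rw [← he, Nat.add_sub_cancel]

theorem exists_adj_dist_add_one_eq {V : Type*} {G : SimpleGraph V} (hG : G.Connected)
    {v x : V} (hx : x ≠ v) : ∃ y, G.Adj x y ∧ G.dist y v + 1 = G.dist x v := by
  obtain ⟨p, hp⟩ := hG.exists_walk_length_eq_dist x v
  cases p with
  | nil => exact absurd rfl hx
  | @cons _ y _ hxy q =>
    refine ⟨y, hxy, ?_⟩
    have h₁ := dist_le q
    have h₂ := hG.dist_triangle (u := x) (v := y) (w := v)
    rw [dist_eq_one_iff_adj.mpr hxy] at h₂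
    rw [Walk.length_cons] at hp
    omega

/-- Every component of `G - v` contains a vertex that is not a cut vertex of `G`. -/
theorem exists_reachable_not_isCutVertex {V : Type*} [Finite V] {G : SimpleGraph V}
    (hG : G.Connected) {v : V} (w : ({v}ᶜ : Set V)) :
    ∃ u : ({v}ᶜ : Set V), (G.induce ({v}ᶜ : Set V)).Reachable w u ∧ ¬ IsCutVertex G u := by
  obtain ⟨u, hwu, hmax⟩ := Set.exists_max_image
    {u | (G.induce ({v}ᶜ : Set V)).Reachable w u} (fun u => G.dist u v)
    (Set.toFinite _) ⟨w, Reachable.refl _⟩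
  refine ⟨u, hwu, not_not.mpr ?_⟩
  have hvu : v ∈ ({u.1}ᶜ : Set V) := fun h => u.2 (Set.mem_singleton_iff.mp h).symm
  have key : ∀ k (x : V) (hx : x ∈ ({u.1}ᶜ : Set V)), G.dist x v = k →
      (G.induce ({u.1}ᶜ : Set V)).Reachable ⟨x, hx⟩ ⟨v, hvu⟩ := by
    intro k
    induction k with
    | zero =>
      intro x hx hk
      obtain rfl := hG.dist_eq_zero_iff.mp hk
      rfl
    | succ k ih =>
      intro x hx hk
      have hxv : x ≠ v := by
        rintro rfl
        simp at hk
      obtain ⟨y, hxy, hd⟩ := exists_adj_dist_add_one_eq hG hxv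
      have hyu : y ≠ u.1 := by
        rintro rfl
        have hux : (G.induce ({v}ᶜ : Set V)).Adj u ⟨x, hxv⟩ := hxy.symm
        have := hmax ⟨x, hxv⟩ (hwu.trans hux.reachable)
        dsimp only at this
        omega
      have hadj : (G.induce ({u.1}ᶜ : Set V)).Adj ⟨x, hx⟩ ⟨y, hyu⟩ := hxy
      exact hadj.reachable.trans (ih y hyu (by omega))
  exact connected_iff_exists_forall_reachable _ |>.mpr
    ⟨⟨v, hvu⟩, fun x => (key _ x.1 x.2 rfl).symm⟩

/-- A connected subgraph containing all vertices that are not cut vertices is spanning. -/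
theorem verts_eq_univ_of_not_isCutVertex_mem {V : Type*} [Finite V] {G : SimpleGraph V}
    (hG : G.Connected) {H : G.Subgraph} (hH : H.Connected)
    (h : ∀ v, ¬ IsCutVertex G v → v ∈ H.verts) : H.verts = Set.univ := by
  refine Set.eq_univ_of_forall fun v => ?_
  by_contra hv
  refine hv (h v (not_not.mpr ?_))
  have hne : ∀ x : H.verts, x.1 ∈ ({v}ᶜ : Set V) := fun x hx =>
    hv (Set.mem_singleton_iff.mp hx ▸ x.2)
  let f : H.coe →g G.induce ({v}ᶜ : Set V) :=
    { toFun := fun x => ⟨x.1, hne x⟩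
      map_rel' := fun hxy => H.adj_sub hxy }
  obtain ⟨x⟩ := hH.coe.nonempty
  refine (connected_iff_exists_forall_reachable _).mpr ⟨f x, fun w => ?_⟩
  obtain ⟨u, hwu, hu⟩ := exists_reachable_not_isCutVertex hG w
  exact ((hH.coe.preconnected x ⟨u, h u hu⟩).map f).trans hwu.symm

/-- For a connected graph `G` of order `n ≥ 5`, `sdiam_{n-3}(G) = n - 1`
if and only if `G` contains at least three cut vertices. -/
theorem sdiam_sub_three_eq_iff_three_cut {V : Type*} [Fintype V] (G : SimpleGraph V)
    (hG : G.Connected) (n : ℕ) (hn : Fintype.card V = n) (hn5 : 5 ≤ n) :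
    sdiam G (n - 3) = (↑(n - 1) : ℕ∞) ↔ 3 ≤ {v : V | IsCutVertex G v}.ncard := by
  have hcard : Nat.card V = n := by rw [Nat.card_eq_fintype_card, hn]
  constructor
  · intro h
    by_contra hlt
    have hle : sdiam G (n - 3) ≤ (n - 2 : ℕ) := by
      refine sSup_le ?_
      rintro _ ⟨S, hS, rfl⟩
      have hSc := Set.ncard_add_ncard_compl S
      obtain ⟨v, hvS, hv⟩ : ∃ v ∈ Sᶜ, v ∉ {v : V | IsCutVertex G v} :=
        Set.exists_mem_notMem_of_ncard_lt_ncard (by omega)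
      have hSv : S ⊆ {v}ᶜ := fun x hx hxv => hvS (Set.mem_singleton_iff.mp hxv ▸ hx)
      have hvc := Set.ncard_add_ncard_compl {v}
      rw [Set.ncard_singleton] at hvc
      have hle := steinerDist_le_ncard_sub_one (not_not.mp hv) hSv
      rwa [show ({v}ᶜ : Set V).ncard - 1 = n - 2 by omega] at hle
    rw [h, Nat.cast_le] at hle
    omega
  · intro h
    refine le_antisymm (sSup_le ?_) ?_
    · rintro _ ⟨S, -, rfl⟩
      have huniv : (G.induce Set.univ).Connected := (induceUnivIso G).connected_iff.mpr hG
      have hle := steinerDist_le_ncard_sub_one huniv (Set.subset_univ S)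
      rwa [Set.ncard_univ, hcard] at hle
    · obtain ⟨T, hT, hT3⟩ := Set.exists_subset_card_eq h
      have hTc := Set.ncard_add_ncard_compl T
      refine le_trans (le_sInf ?_) (le_sSup ⟨Tᶜ, by omega, rfl⟩)
      rintro _ ⟨H, hH, hTH, rfl⟩
      have hspan := verts_eq_univ_of_not_isCutVertex_mem hG hH
        fun v hv => hTH fun hvT => hv (hT hvT)
      have hle := ncard_verts_le_ncard_edgeSet_add_one hH
      rw [hspan, Set.ncard_univ, hcard] at hle
      exact Nat.cast_le.mpr (by omega)
end

section
/- Let G be a connected graph whose unique cut vertex is u, and let C be a connected component of G − u with at least 3 vertices. Then the induced subgraph G[V(C) ∪ {u}] is 2-connected (it has no cut vertex). -/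
open SimpleGraph

/-- Let `r ∈ A ∩ D`, and suppose that edges of `G[D]` can leave `A` only at `r`. If every vertex
of `A ∩ D` is joined to `r` in `G[D]`, then `G[A ∩ D]` is connected. -/
theorem connected_induce_inter {V : Type*} (G : SimpleGraph V) {A D : Set V} {r : V}
    (hrA : r ∈ A) (hrD : r ∈ D)
    (hclosed : ∀ a ∈ A, ∀ b ∈ D, a ∈ D → a ≠ r → G.Adj a b → b ∈ A)
    (hreach : ∀ a, a ∈ A → ∀ ha : a ∈ D, (G.induce D).Reachable ⟨a, ha⟩ ⟨r, hrD⟩) :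
    (G.induce (A ∩ D)).Connected := by
  have key : ∀ (x y : D), (G.induce D).Walk x y → y.1 = r → ∀ hx : x.1 ∈ A,
      (G.induce (A ∩ D)).Reachable ⟨x.1, hx, x.2⟩ ⟨r, hrA, hrD⟩ := by
    intro x y p
    induction p with
    | nil =>
      rintro rfl hx
      exact Reachable.refl _
    | @cons a b _ hab _ ih =>
      intro hy ha
      by_cases har : a.1 = r
      · subst har
        exact Reachable.refl _
      · have hb := hclosed _ ha _ b.2 a.2 har hab
        have hstep : (G.induce (A ∩ D)).Adj ⟨a.1, ha, a.2⟩ ⟨b.1, hb, b.2⟩ := hab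
        exact hstep.reachable.trans (ih hy hb)
  refine (connected_iff_exists_forall_reachable _).2 ⟨⟨r, hrA, hrD⟩, fun a => ?_⟩
  obtain ⟨p⟩ := hreach a.1 a.2.1 a.2.2
  exact (key _ _ p rfl a.2.1).symm

/-- If `u` is the unique cut vertex of a connected graph `G` and `C` is a
connected component of `G - u` with at least 3 vertices, then `G[V(C) ∪ {u}]` is
2-connected (connected with no cut vertex). -/
theorem induce_component_two_connected {V : Type*} [Fintype V] (G : SimpleGraph V)
    (hG : G.Connected) (u : V) (hu : IsCutVertex G u)
    (huniq : ∀ w : V, IsCutVertex G w → w = u)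
    (c : (G.induce ({u}ᶜ : Set V)).ConnectedComponent)
    (C : Set V) (hC : C = Subtype.val '' c.supp) (hC3 : 3 ≤ C.ncard) :
    (G.induce (C ∪ {u})).Connected ∧ ∀ w ∈ C ∪ {u}, ¬ IsCutSetOf G (C ∪ {u}) {w} := by
  subst hC
  have hclosed : ∀ a ∈ Subtype.val '' c.supp, ∀ b, b ≠ u → G.Adj a b →
      b ∈ Subtype.val '' c.supp := by
    rintro _ ⟨a, ha, rfl⟩ b hb hab
    have hadj : (G.induce ({u}ᶜ : Set V)).Adj a ⟨b, hb⟩ := hab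
    exact ⟨⟨b, hb⟩, c.mem_supp_of_adj_mem_supp ha hadj, rfl⟩
  have hclosed_union : ∀ a ∈ Subtype.val '' c.supp ∪ {u}, ∀ b, a ≠ u → G.Adj a b →
      b ∈ Subtype.val '' c.supp ∪ {u} := by
    rintro a (ha | ha) b hau hab
    · by_cases hb : b = u
      · exact Or.inr hb
      · exact Or.inl (hclosed a ha b hb hab)
    · exact absurd ha hau
  constructor
  · rw [← Set.inter_univ (Subtype.val '' c.supp ∪ {u})]
    refine connected_induce_inter G (Or.inr rfl) (Set.mem_univ u)
      (fun a ha b _ _ => hclosed_union a ha b) fun a _ _ => ?_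
    exact ((induceUnivIso G).connected_iff.2 hG).preconnected _ _
  · rintro w - ⟨-, hw⟩
    apply hw
    by_cases hwu : w = u
    · subst hwu
      obtain ⟨v, hv⟩ := c.nonempty_supp
      rw [Set.union_sdiff_right, Set.sdiff_eq]
      refine connected_induce_inter G ⟨v, hv, rfl⟩ v.2
        (fun a ha b hb _ _ => hclosed a ha b hb) ?_
      rintro _ ⟨a, ha, rfl⟩ _
      exact c.reachable_of_mem_supp ha hv
    · have hconn : (G.induce ({w}ᶜ : Set V)).Connected := by
        by_contra h
        exact hwu (huniq w h)
      rw [Set.sdiff_eq]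
      exact connected_induce_inter G (Or.inr rfl) (Ne.symm hwu)
        (fun a ha b _ _ => hclosed_union a ha b) fun _ _ _ => hconn.preconnected _ _
end
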